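/- Main theorem (parameter-uniform first-order convergence of the fitted operator scheme on non-uniform meshes): there exist constants C₀ > 0 and C, depending only on a, f, T, α and the initial value u₀, but not on ε or N, such that for every ε ∈ (0,1], every N ≥ 1, and every mesh 0 = t_0 < ... < t_N = T with h_j ≤ C₀ N⁻¹ for all j, the following holds. Let u be the solution of ε u' + a u = f on [0,T] with u(0) = u₀, and let U : {0,...,N} → ℝ be the fitted backward Euler solution defined by U_0 = u₀ and ε σ_j (U_j − U_{j−1})/h_j + a(t_j) U_j = f(t_j) for 1 ≤ j ≤ N, where σ_j = a(t_j) ρ_j/(e^{a(t_j) ρ_j} − 1) and ρ_j = h_j/ε. Assume u₀ − f(0)/a(0) ≥ 0. Then max_{0 ≤ j ≤ N} |U_j − u(t_j)| ≤ C N⁻¹. -/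

import Mathlib

open Set

/-- A function with `ε u' + c u ≤ r` on `[p, q]` lies below the solution of the
constant-coefficient equation with the same initial value. -/
lemma le_constant_coefficient_solution {ε c r p q : ℝ} (hε : 0 < ε) (hc : 0 < c) (hpq : p ≤ q)
    {u u' : ℝ → ℝ} (hu : ∀ s ∈ Set.Icc p q, HasDerivAt u (u' s) s)
    (hr : ∀ s ∈ Set.Icc p q, ε * u' s + c * u s ≤ r) :
    u q ≤ Real.exp (-(c * ((q - p) / ε))) * u p
      + (1 - Real.exp (-(c * ((q - p) / ε)))) * (r / c) := by
  have hd : ∀ s ∈ Set.Icc p q, HasDerivAt (fun s => Real.exp (c * ((s - p) / ε)) * (u s - r / c))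
      (Real.exp (c * ((s - p) / ε)) * (c * (1 / ε)) * (u s - r / c)
        + Real.exp (c * ((s - p) / ε)) * u' s) s := fun s hs =>
    ((((hasDerivAt_id s).sub_const p).div_const ε).const_mul c).exp.mul ((hu s hs).sub_const _)
  have hanti := antitoneOn_of_deriv_nonpos (convex_Icc p q)
    (fun s hs => (hd s hs).continuousAt.continuousWithinAt)
    (fun s hs => (hd s (interior_subset hs)).differentiableAt.differentiableWithinAt) (by
      intro s hs
      have hs' := interior_subset hs
      rw [(hd s hs').deriv]
      have : Real.exp (c * ((s - p) / ε)) * (c * (1 / ε)) * (u s - r / c)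
          + Real.exp (c * ((s - p) / ε)) * u' s
          = Real.exp (c * ((s - p) / ε)) / ε * (ε * u' s + c * u s - r) := by
        field_simp
        ring
      rw [this]
      exact mul_nonpos_of_nonneg_of_nonpos (by positivity) (by linarith [hr s hs']))
  have h := hanti (Set.left_mem_Icc.2 hpq) (Set.right_mem_Icc.2 hpq) hpq
  simp only [sub_self, zero_div, mul_zero, Real.exp_zero, one_mul] at h
  have h' := mul_le_mul_of_nonneg_left h (Real.exp_pos (-(c * ((q - p) / ε)))).le
  rw [← mul_assoc, ← Real.exp_add, neg_add_cancel, Real.exp_zero, one_mul] at h'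
  linarith

lemma abs_sub_constant_coefficient_solution_le {ε c d R p q : ℝ} (hε : 0 < ε) (hc : 0 < c)
    (hpq : p ≤ q) {u u' : ℝ → ℝ} (hu : ∀ s ∈ Set.Icc p q, HasDerivAt u (u' s) s)
    (hR : ∀ s ∈ Set.Icc p q, |ε * u' s + c * u s - d| ≤ R) :
    |Real.exp (-(c * ((q - p) / ε))) * u p
      + (1 - Real.exp (-(c * ((q - p) / ε)))) * (d / c) - u q|
      ≤ (1 - Real.exp (-(c * ((q - p) / ε)))) * (R / c) := by
  have h₁ := le_constant_coefficient_solution hε hc hpq hu (r := d + R)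
    fun s hs => by linarith [(abs_le.1 (hR s hs)).2]
  have h₂ := le_constant_coefficient_solution hε hc hpq (u := fun s => -u s)
    (u' := fun s => -u' s) (fun s hs => (hu s hs).neg) (r := -d + R)
    fun s hs => by linarith [(abs_le.1 (hR s hs)).1]
  rw [add_div] at h₁ h₂
  rw [neg_div] at h₂
  rw [abs_le]
  constructor <;> linarith

/-- One-sided maximum principle for `ε u' + a u = f`. -/
lemma le_of_singularly_perturbed_ode {ε T B : ℝ} (hε : 0 < ε) {a f u u' : ℝ → ℝ}
    (hu : ∀ t ∈ Set.Icc (0:ℝ) T, HasDerivAt u (u' t) t)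
    (hode : ∀ t ∈ Set.Icc (0:ℝ) T, ε * u' t + a t * u t = f t)
    (h₀ : u 0 ≤ B) (hB : ∀ t ∈ Set.Icc (0:ℝ) T, f t < a t * B) :
    ∀ t ∈ Set.Icc (0:ℝ) T, u t ≤ B := by
  intro t ht
  refine image_le_of_deriv_right_lt_deriv_boundary (f := u) (f' := u') (B := fun _ => B)
    (B' := fun _ => 0) (fun s hs => (hu s hs).continuousAt.continuousWithinAt)
    (fun s hs => (hu s (Set.Ico_subset_Icc_self hs)).hasDerivWithinAt) h₀
    (fun s => hasDerivAt_const s B) (fun s hs heq => ?_) ht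
  have hs' := Set.Ico_subset_Icc_self hs
  have h₁ := hode s hs'
  have h₂ := hB s hs'
  rw [heq] at h₁
  by_contra! hneg
  have := mul_nonneg hε.le hneg
  linarith

/-- Uniform bound for the solution, independent of `ε`. -/
lemma abs_le_of_singularly_perturbed_ode {ε T B : ℝ} (hε : 0 < ε) {a f u u' : ℝ → ℝ}
    (hu : ∀ t ∈ Set.Icc (0:ℝ) T, HasDerivAt u (u' t) t)
    (hode : ∀ t ∈ Set.Icc (0:ℝ) T, ε * u' t + a t * u t = f t)
    (h₀ : |u 0| ≤ B) (hB : ∀ t ∈ Set.Icc (0:ℝ) T, |f t| < a t * B) :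
    ∀ t ∈ Set.Icc (0:ℝ) T, |u t| ≤ B := by
  intro t ht
  have h₁ := le_of_singularly_perturbed_ode hε hu hode (abs_le.1 h₀).2
    (fun s hs => (abs_lt.1 (hB s hs)).2) t ht
  have h₂ := le_of_singularly_perturbed_ode (a := a) (B := B) (u := fun s => -u s)
    (u' := fun s => -u' s) (f := fun s => -f s) hε (fun s hs => (hu s hs).neg)
    (fun s hs => by linarith [hode s hs]) (by linarith [(abs_le.1 h₀).1])
    (fun s hs => by linarith [(abs_lt.1 (hB s hs)).1]) t ht
  exact abs_le.2 ⟨by linarith, h₁⟩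

/-- A function with continuous derivative on `[0, T]` is Lipschitz there. -/
lemma exists_lipschitz_bound_of_continuousOn_deriv {T : ℝ} {g g' : ℝ → ℝ}
    (hg : ∀ t ∈ Set.Icc (0:ℝ) T, HasDerivAt g (g' t) t)
    (hg' : ContinuousOn g' (Set.Icc 0 T)) :
    ∃ L : ℝ, 0 ≤ L ∧ ∀ s ∈ Set.Icc (0:ℝ) T, ∀ t ∈ Set.Icc (0:ℝ) T,
      |g t - g s| ≤ L * |t - s| := by
  obtain ⟨L, hL⟩ := isCompact_Icc.exists_bound_of_continuousOn hg'
  refine ⟨max L 0, le_max_right _ _, fun s hs t ht => ?_⟩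
  exact (convex_Icc 0 T).norm_image_sub_le_of_norm_hasDerivWithin_le
    (fun x hx => (hg x hx).hasDerivWithinAt) (fun x hx => (hL x hx).trans (le_max_left _ _)) hs ht

/-- One step of the fitted scheme is exact for the frozen coefficients. -/
lemma fitted_step_eq {ε c d h x y : ℝ} (hε : 0 < ε) (hc : 0 < c) (hh : 0 < h)
    (hstep : ε * (c * (h / ε) / (Real.exp (c * (h / ε)) - 1)) * (y - x) / h + c * y = d) :
    y = Real.exp (-(c * (h / ε))) * x + (1 - Real.exp (-(c * (h / ε)))) * (d / c) := by
  have hE : 1 < Real.exp (c * (h / ε)) := Real.one_lt_exp_iff.2 (by positivity)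
  rw [Real.exp_neg]
  generalize Real.exp (c * (h / ε)) = E at hstep hE ⊢
  have hE₁ : E - 1 ≠ 0 := by linarith
  have hE₀ : E ≠ 0 := by linarith
  rw [← hstep]
  field_simp
  ring

/-- First-order convergence, uniform in `ε`, on every mesh in `[0, T]`: the error is at most a
constant times any bound `H` on the step sizes. -/
theorem fitted_operator_error_le_mesh_width
    {T α u₀ : ℝ} (hα : 0 < α) {a a' f f' : ℝ → ℝ}
    (ha_deriv : ∀ t ∈ Set.Icc (0:ℝ) T, HasDerivAt a (a' t) t)
    (ha'_cont : ContinuousOn a' (Set.Icc 0 T))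
    (ha : ∀ t ∈ Set.Icc (0:ℝ) T, α ≤ a t)
    (hf_deriv : ∀ t ∈ Set.Icc (0:ℝ) T, HasDerivAt f (f' t) t)
    (hf'_cont : ContinuousOn f' (Set.Icc 0 T)) :
    ∃ K : ℝ, 0 ≤ K ∧ ∀ ε : ℝ, 0 < ε → ∀ u u' : ℝ → ℝ,
      (∀ t ∈ Set.Icc (0:ℝ) T, HasDerivAt u (u' t) t) →
      (∀ t ∈ Set.Icc (0:ℝ) T, ε * u' t + a t * u t = f t) →
      u 0 = u₀ →
      ∀ (N : ℕ) (t : ℕ → ℝ) (H : ℝ), 0 ≤ H →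
        t 0 = 0 → t N = T → (∀ j : ℕ, 1 ≤ j → j ≤ N → t (j - 1) < t j) →
        (∀ j : ℕ, 1 ≤ j → j ≤ N → t j - t (j - 1) ≤ H) →
        ∀ U : ℕ → ℝ, U 0 = u₀ →
        (∀ j : ℕ, 1 ≤ j → j ≤ N →
          ε * (a (t j) * ((t j - t (j - 1)) / ε) /
                (Real.exp (a (t j) * ((t j - t (j - 1)) / ε)) - 1)) *
              (U j - U (j - 1)) / (t j - t (j - 1)) + a (t j) * U j = f (t j)) →
        ∀ j : ℕ, j ≤ N → |U j - u (t j)| ≤ K * H := by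
  obtain ⟨La, hLa₀, hLa⟩ := exists_lipschitz_bound_of_continuousOn_deriv ha_deriv ha'_cont
  obtain ⟨Lf, hLf₀, hLf⟩ := exists_lipschitz_bound_of_continuousOn_deriv hf_deriv hf'_cont
  obtain ⟨F, hF⟩ := isCompact_Icc.exists_bound_of_continuousOn (f := f) (s := Set.Icc 0 T)
    fun s hs => (hf_deriv s hs).continuousAt.continuousWithinAt
  set B := |u₀| + |F| / α + 1 with hBdef
  have hB₀ : 0 < B := by positivity
  have hfB : ∀ s ∈ Set.Icc (0:ℝ) T, |f s| < a s * B := fun s hs =>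
    calc |f s| ≤ |F| := (hF s hs).trans (le_abs_self F)
      _ = α * (|F| / α) := by field_simp
      _ < α * B := by
        gcongr
        linarith [abs_nonneg u₀]
      _ ≤ a s * B := by
        gcongr
        exact ha s hs
  refine ⟨(Lf + La * B) / α, by positivity, ?_⟩
  intro ε hε u u' hu hode hu0 N t H hH ht0 htN hlt hstep U hU0 hU
  have huB := abs_le_of_singularly_perturbed_ode hε hu hode (B := B)
    (by rw [hu0, hBdef]; linarith [div_nonneg (abs_nonneg F) hα.le]) hfB
  have hmono : ∀ i j : ℕ, i ≤ j → j ≤ N → t i ≤ t j := by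
    intro i j hij
    induction j, hij using Nat.le_induction with
    | base => exact fun _ => le_rfl
    | succ k _ ih =>
      intro hk
      exact (ih (by omega)).trans (hlt (k + 1) (by omega) hk).le
  have hmem : ∀ j, j ≤ N → t j ∈ Set.Icc 0 T := fun j hj =>
    ⟨ht0 ▸ hmono 0 j (Nat.zero_le j) hj, htN ▸ hmono j N hj le_rfl⟩
  intro j
  induction j with
  | zero =>
    intro _
    rw [hU0, ht0, hu0, sub_self, abs_zero]
    positivity
  | succ k ih =>
    intro hk
    have hlt' := hlt (k + 1) (by omega) hk
    have hstep' := hstep (k + 1) (by omega) hk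
    have hU' := hU (k + 1) (by omega) hk
    rw [Nat.add_sub_cancel] at hlt' hstep' hU'
    have hm := hmem (k + 1) hk
    have hm' := hmem k (by omega)
    have hα' := ha _ hm
    have hc : 0 < a (t (k + 1)) := hα.trans_le hα'
    have hres : ∀ s ∈ Set.Icc (t k) (t (k + 1)),
        |ε * u' s + a (t (k + 1)) * u s - f (t (k + 1))| ≤ (Lf + La * B) * H := by
      intro s hs
      have hsT : s ∈ Set.Icc 0 T := ⟨hm'.1.trans hs.1, hs.2.trans hm.2⟩
      have hdist : |t (k + 1) - s| ≤ H := by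
        rw [abs_of_nonneg (by linarith [hs.2])]
        linarith [hs.1]
      have e : ε * u' s + a (t (k + 1)) * u s - f (t (k + 1))
          = (a (t (k + 1)) - a s) * u s - (f (t (k + 1)) - f s) := by
        linarith [hode s hsT]
      calc _ ≤ |a (t (k + 1)) - a s| * |u s| + |f (t (k + 1)) - f s| := by
            rw [e, ← abs_mul]
            exact abs_sub _ _
        _ ≤ (La * H) * B + Lf * H := by
            gcongr
            · exact (hLa s hsT _ hm).trans (by gcongr)
            · exact huB s hsT
            · exact (hLf s hsT _ hm).trans (by gcongr)
        _ = (Lf + La * B) * H := by ring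
    have hcons := abs_sub_constant_coefficient_solution_le hε hc hlt'.le
      (fun s hs => hu s ⟨hm'.1.trans hs.1, hs.2.trans hm.2⟩) hres
    rw [fitted_step_eq hε hc (sub_pos.2 hlt') hU']
    have hE₁ : Real.exp (-(a (t (k + 1)) * ((t (k + 1) - t k) / ε))) ≤ 1 := by
      rw [Real.exp_le_one_iff, neg_nonpos]
      have := sub_pos.2 hlt'
      positivity
    have hE₀ := Real.exp_pos (-(a (t (k + 1)) * ((t (k + 1) - t k) / ε)))
    generalize Real.exp (-(a (t (k + 1)) * ((t (k + 1) - t k) / ε))) = E at *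
    have hR : (Lf + La * B) * H / a (t (k + 1)) ≤ (Lf + La * B) / α * H := by
      rw [div_mul_eq_mul_div]
      gcongr
    calc |E * U k + (1 - E) * (f (t (k + 1)) / a (t (k + 1))) - u (t (k + 1))|
        = |E * (U k - u (t k)) + (E * u (t k) + (1 - E) * (f (t (k + 1)) / a (t (k + 1)))
            - u (t (k + 1)))| := by ring_nf
      _ ≤ E * |U k - u (t k)| + (1 - E) * ((Lf + La * B) * H / a (t (k + 1))) := by
          refine (abs_add_le _ _).trans (add_le_add ?_ hcons)
          rw [abs_mul, abs_of_pos hE₀]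
      _ ≤ E * ((Lf + La * B) / α * H) + (1 - E) * ((Lf + La * B) / α * H) := by
          have := ih (by omega)
          have := sub_nonneg.2 hE₁
          gcongr
      _ = (Lf + La * B) / α * H := by ring

/-- Main theorem: parameter-uniform first-order convergence of the fitted backward
Euler scheme on non-uniform meshes satisfying `h_j ≤ C₀ N⁻¹`. -/
theorem fitted_operator_parameter_uniform_convergence
    (T α u₀ : ℝ) (hT : 0 < T) (hα : 0 < α)
    (a a' f f' : ℝ → ℝ)
    (ha_deriv : ∀ t ∈ Set.Icc (0:ℝ) T, HasDerivAt a (a' t) t)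
    (ha'_cont : ContinuousOn a' (Set.Icc 0 T))
    (ha : ∀ t ∈ Set.Icc (0:ℝ) T, α ≤ a t)
    (hf_deriv : ∀ t ∈ Set.Icc (0:ℝ) T, HasDerivAt f (f' t) t)
    (hf'_cont : ContinuousOn f' (Set.Icc 0 T))
    (hu₀ : 0 ≤ u₀ - f 0 / a 0) :
    ∃ C₀ : ℝ, 0 < C₀ ∧ ∃ C : ℝ, ∀ ε ∈ Set.Ioc (0:ℝ) 1, ∀ u u' : ℝ → ℝ,
      (∀ t ∈ Set.Icc (0:ℝ) T, HasDerivAt u (u' t) t) →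
      (∀ t ∈ Set.Icc (0:ℝ) T, ε * u' t + a t * u t = f t) →
      u 0 = u₀ →
      -- the smooth component `v` exists and is twice differentiable
      (∃ v v' v'' : ℝ → ℝ,
        (∀ t ∈ Set.Icc (0:ℝ) T, HasDerivAt v (v' t) t) ∧
        (∀ t ∈ Set.Icc (0:ℝ) T, HasDerivAt v' (v'' t) t) ∧
        (∀ t ∈ Set.Icc (0:ℝ) T, ε * v' t + a t * v t = f t) ∧
        v 0 = f 0 / a 0) →
      ∀ (N : ℕ), 1 ≤ N → ∀ t : ℕ → ℝ,
        t 0 = 0 → t N = T → (∀ j : ℕ, 1 ≤ j → j ≤ N → t (j - 1) < t j) →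
        (∀ j : ℕ, 1 ≤ j → j ≤ N → t j - t (j - 1) ≤ C₀ * (N : ℝ)⁻¹) →
        ∀ U : ℕ → ℝ, U 0 = u₀ →
        (∀ j : ℕ, 1 ≤ j → j ≤ N →
          ε * (a (t j) * ((t j - t (j - 1)) / ε) /
                (Real.exp (a (t j) * ((t j - t (j - 1)) / ε)) - 1)) *
              (U j - U (j - 1)) / (t j - t (j - 1)) + a (t j) * U j = f (t j)) →
        ∀ j : ℕ, j ≤ N → |U j - u (t j)| ≤ C * (N : ℝ)⁻¹ := by
  obtain ⟨K, -, hK⟩ := fitted_operator_error_le_mesh_width (u₀ := u₀) hα ha_deriv ha'_cont ha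
    hf_deriv hf'_cont
  refine ⟨2 * T, by positivity, K * (2 * T), ?_⟩
  intro ε hε u u' hu hode hu0 _ N _ t ht0 htN hlt hstep U hU0 hU j hj
  rw [mul_assoc]
  exact hK ε hε.1 u u' hu hode hu0 N t _ (by positivity) ht0 htN hlt hstep U hU0 hU j hj
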